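/- arXiv:2407.16346 — 2 statements merged into one kernel-verified Lean document; each statement's English description precedes it below -/
import Mathlib

section
/- Let ‖·‖ be a norm on ℝ^m with dual norm ‖x‖_* = sup{ v^⊤x : v ∈ ℝ^m, ‖v‖ ≤ 1 }, and for a matrix Δ ∈ ℝ^{d×m} define the operator norm ‖Δ‖_op = sup{ ‖Δv‖_1 : v ∈ ℝ^m, ‖v‖ ≤ 1 }, where ‖·‖_1 is the ℓ1 norm on ℝ^d. Then for every y ∈ ℝ^d, x ∈ ℝ^m and θ ≥ 0: sup{ y^⊤Δx : Δ ∈ ℝ^{d×m}, ‖Δ‖_op ≤ θ } = θ·‖y‖_∞·‖x‖, where ‖y‖_∞ = max_i |y_i|; moreover the supremum is attained, for instance at Δ = θ·ỹ·x̃^⊤, where x̃ ∈ ℝ^m satisfies x̃^⊤x = ‖x‖ and ‖x̃‖_* = 1, and ỹ ∈ ℝ^d satisfies ỹ^⊤y = ‖y‖_∞ and ‖ỹ‖_1 = 1. -/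
noncomputable section

namespace NestedDRO

/-- `N` is a norm on the real vector space `V`. -/
def IsNorm {V : Type*} [AddCommGroup V] [Module ℝ V] (N : V → ℝ) : Prop :=
  (∀ v, N v = 0 ↔ v = 0) ∧ (∀ (a : ℝ) (v : V), N (a • v) = |a| * N v) ∧
    ∀ v w, N (v + w) ≤ N v + N w

/-- Euclidean inner product. -/
def dot {a : ℕ} (u v : Fin a → ℝ) : ℝ := ∑ i, u i * v i

/-- The dual norm `‖x‖_* = sup { vᵀx : ‖v‖ ≤ 1 }`. -/
def dualNorm {k : ℕ} (N : (Fin k → ℝ) → ℝ) (x : Fin k → ℝ) : ℝ :=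
  sSup ((fun v => dot v x) '' {v | N v ≤ 1})

/-- The operator norm `‖Δ‖_op = sup { ‖Δv‖₁ : ‖v‖ ≤ 1 }` from `(ℝ^m, ‖·‖)` to
`(ℝ^d, ‖·‖₁)`. -/
def opNorm {d k : ℕ} (N : (Fin k → ℝ) → ℝ) (Δ : Fin d → Fin k → ℝ) : ℝ :=
  sSup ((fun v => ∑ i, |∑ j, Δ i j * v j|) '' {v | N v ≤ 1})

/-- The coordinate space `ℝ^k`, to be normed by a given norm `N`. -/
def NormedCopy {k : ℕ} (N : (Fin k → ℝ) → ℝ) (_ : IsNorm N) : Type := Fin k → ℝ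

namespace IsNorm

theorem map_zero {V : Type*} [AddCommGroup V] [Module ℝ V] {N : V → ℝ} (h : IsNorm N) :
    N 0 = 0 := (h.1 0).2 rfl

theorem map_neg {V : Type*} [AddCommGroup V] [Module ℝ V] {N : V → ℝ} (h : IsNorm N) (v : V) :
    N (-v) = N v := by
  simpa using h.2.1 (-1) v

theorem nonneg {V : Type*} [AddCommGroup V] [Module ℝ V] {N : V → ℝ} (h : IsNorm N) (v : V) :
    0 ≤ N v := by
  have := h.2.2 v (-v)
  rw [add_neg_cancel, h.map_zero, h.map_neg] at this
  linarith

end IsNorm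

section NormedCopy

variable {k : ℕ} {N : (Fin k → ℝ) → ℝ} {h : IsNorm N}

instance : AddCommGroup (NormedCopy N h) := inferInstanceAs (AddCommGroup (Fin k → ℝ))

instance : Module ℝ (NormedCopy N h) := inferInstanceAs (Module ℝ (Fin k → ℝ))

instance : FiniteDimensional ℝ (NormedCopy N h) :=
  inferInstanceAs (FiniteDimensional ℝ (Fin k → ℝ))

instance : Norm (NormedCopy N h) := ⟨N⟩

theorem NormedCopy.core : NormedSpace.Core ℝ (NormedCopy N h) where
  norm_nonneg v := h.nonneg v
  norm_smul a v := h.2.1 a v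
  norm_triangle v w := h.2.2 v w
  norm_eq_zero_iff v := h.1 v

instance : NormedAddCommGroup (NormedCopy N h) := NormedAddCommGroup.ofCore NormedCopy.core

instance : NormedSpace ℝ (NormedCopy N h) := NormedSpace.ofCore NormedCopy.core

/-- The identity map between the two normings of `ℝ^k`. -/
def NormedCopy.equiv (h : IsNorm N) : NormedCopy N h ≃ₗ[ℝ] (Fin k → ℝ) :=
  LinearEquiv.refl ℝ (Fin k → ℝ)

end NormedCopy

namespace IsNorm

variable {k : ℕ} {N : (Fin k → ℝ) → ℝ}

theorem exists_norm_le (h : IsNorm N) : ∃ C, 0 ≤ C ∧ ∀ v, ‖v‖ ≤ C * N v := by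
  let L : NormedCopy N h →L[ℝ] (Fin k → ℝ) :=
    LinearMap.toContinuousLinearMap (NormedCopy.equiv h).toLinearMap
  exact ⟨‖L‖, norm_nonneg _, fun v => L.le_opNorm ((NormedCopy.equiv h).symm v)⟩

theorem exists_norming_vector (h : IsNorm N) (x : Fin k → ℝ) :
    ∃ u, (∀ v, |dot u v| ≤ N v) ∧ dot u x = N x := by
  obtain ⟨g, hg, hgx⟩ := exists_dual_vector'' ℝ ((NormedCopy.equiv h).symm x)
  have hdot (v : Fin k → ℝ) :
      dot (fun i => g ((NormedCopy.equiv h).symm (Pi.single i 1))) v =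
        g ((NormedCopy.equiv h).symm v) := by
    conv_rhs => rw [pi_eq_sum_univ' v]
    simp [dot, mul_comm]
  refine ⟨_, fun v => ?_, (hdot x).trans hgx⟩
  rw [hdot]
  exact g.le_of_opNorm_le hg ((NormedCopy.equiv h).symm v) |>.trans_eq (one_mul _)

theorem bddAbove_image_unitBall (h : IsNorm N) {f : (Fin k → ℝ) → ℝ} (hf : Continuous f) :
    BddAbove (f '' {v | N v ≤ 1}) := by
  obtain ⟨C, hC, hN⟩ := h.exists_norm_le
  refine ((isCompact_closedBall (0 : Fin k → ℝ) C).bddAbove_image hf.continuousOn).mono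
    (Set.image_mono fun v hv => ?_)
  rw [mem_closedBall_zero_iff]
  exact (hN v).trans (mul_le_of_le_one_right hC hv)

theorem le_sSup_unitBall_mul (h : IsNorm N) {f : (Fin k → ℝ) → ℝ} (hf : Continuous f)
    (hhom : ∀ a : ℝ, 0 ≤ a → ∀ v, f (a • v) = a * f v) (v : Fin k → ℝ) :
    f v ≤ sSup (f '' {v | N v ≤ 1}) * N v := by
  rcases (h.nonneg v).eq_or_lt with hv | hv
  · have hf0 : f 0 = 0 := by simpa using hhom 0 le_rfl 0
    rw [← hv, (h.1 v).1 hv.symm, hf0, mul_zero]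
  · have hmem : f ((N v)⁻¹ • v) ∈ f '' {v | N v ≤ 1} := by
      refine Set.mem_image_of_mem f ?_
      rw [Set.mem_ofPred_eq, h.2.1, abs_of_pos (inv_pos.2 hv), inv_mul_cancel₀ hv.ne']
    have := le_csSup (h.bddAbove_image_unitBall hf) hmem
    rwa [hhom _ (inv_pos.2 hv).le, inv_mul_le_iff₀ hv, mul_comm] at this

theorem sum_abs_le_opNorm_mul (h : IsNorm N) {d : ℕ} (Δ : Fin d → Fin k → ℝ) (v : Fin k → ℝ) :
    ∑ i, |∑ j, Δ i j * v j| ≤ opNorm N Δ * N v := by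
  refine h.le_sSup_unitBall_mul (f := fun v => ∑ i, |∑ j, Δ i j * v j|) (by fun_prop)
    (fun a ha v => ?_) v
  simp only [Pi.smul_apply, smul_eq_mul, mul_left_comm _ a, ← Finset.mul_sum, abs_mul,
    abs_of_nonneg ha]

theorem abs_dot_le_dualNorm_mul (h : IsNorm N) (u v : Fin k → ℝ) :
    |dot u v| ≤ dualNorm N u * N v := by
  have key (v : Fin k → ℝ) : dot v u ≤ dualNorm N u * N v := by
    refine h.le_sSup_unitBall_mul (f := fun v => dot v u) (by unfold dot; fun_prop)
      (fun a _ v => ?_) v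
    simp [dot, Finset.mul_sum, mul_assoc]
  have hcomm : dot u v = dot v u := by simp [dot, mul_comm]
  have hneg : dot (-v) u = -dot v u := by simp [dot]
  rw [hcomm, abs_le']
  exact ⟨key v, by simpa [hneg, h.map_neg] using key (-v)⟩

theorem opNorm_rankOne_le (h : IsNorm N) {d : ℕ} {θ : ℝ} (hθ : 0 ≤ θ) {u : Fin k → ℝ}
    {w : Fin d → ℝ} (hu : ∀ v, |dot u v| ≤ N v) (hw : ∑ i, |w i| ≤ 1) :
    opNorm N (fun i j => θ * w i * u j) ≤ θ := by
  refine csSup_le (Set.Nonempty.image _ ⟨0, by simp [h.map_zero]⟩) ?_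
  rintro _ ⟨v, hv, rfl⟩
  have hv1 : |dot u v| ≤ 1 := (hu v).trans hv
  calc ∑ i, |∑ j, θ * w i * u j * v j| = θ * ((∑ i, |w i|) * |dot u v|) := by
        simp only [mul_assoc, ← Finset.mul_sum, abs_mul, abs_of_nonneg hθ, dot, Finset.sum_mul]
    _ ≤ θ * (1 * 1) := by gcongr
    _ = θ := by ring

end IsNorm

theorem sum_mul_rankOne {d k : ℕ} (θ : ℝ) (y w : Fin d → ℝ) (x u : Fin k → ℝ) :
    ∑ i, y i * ∑ j, θ * w i * u j * x j = θ * dot w y * dot u x := by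
  simp only [dot, Finset.mul_sum, Finset.sum_mul]
  rw [Finset.sum_comm]
  exact Finset.sum_congr rfl fun _ _ => Finset.sum_congr rfl fun _ _ => by ring

theorem exists_dot_eq_iSup_abs {d : ℕ} (y : Fin d → ℝ) :
    ∃ w : Fin d → ℝ, ∑ i, |w i| ≤ 1 ∧ dot w y = ⨆ i, |y i| := by
  rcases isEmpty_or_nonempty (Fin d) with hd | hd
  · exact ⟨0, by simp, by simp [dot]⟩
  · obtain ⟨i, hi⟩ := exists_eq_ciSup_of_finite (f := fun i => |y i|)
    refine ⟨Pi.single i (SignType.sign (y i) : ℝ), ?_, ?_⟩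
    · rw [Finset.sum_eq_single i (fun j _ hj => by simp [hj]) (by simp), Pi.single_eq_same]
      rcases lt_trichotomy (y i) 0 with h | h | h <;> simp [h]
    · rw [← hi]
      simp [dot, Pi.single_apply, sign_mul_self]

theorem sum_mul_le_iSup_abs_mul_sum_abs {d : ℕ} (y z : Fin d → ℝ) :
    ∑ i, y i * z i ≤ (⨆ i, |y i|) * ∑ i, |z i| := by
  rw [Finset.mul_sum]
  refine Finset.sum_le_sum fun i _ => (le_abs_self _).trans ?_
  rw [abs_mul]
  gcongr
  exact le_ciSup (f := fun i => |y i|) (Set.finite_range _).bddAbove i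

/-- For any norm `‖·‖` on `ℝ^m` with dual norm `‖·‖_*` and the induced
operator norm into `(ℝ^d, ‖·‖₁)`, for every `y ∈ ℝ^d`, `x ∈ ℝ^m` and `θ ≥ 0` one has
`sup { yᵀΔx : ‖Δ‖_op ≤ θ } = θ‖y‖_∞‖x‖`, and the supremum is attained at
`Δ = θ ỹ x̃ᵀ` for any `x̃` with `x̃ᵀx = ‖x‖`, `‖x̃‖_* = 1` and any `ỹ` with `ỹᵀy = ‖y‖_∞`,
`‖ỹ‖₁ = 1`. -/
theorem statement18 {d m : ℕ} (Nm : (Fin m → ℝ) → ℝ) (hNm : IsNorm Nm)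
    (y : Fin d → ℝ) (x : Fin m → ℝ) (θ : ℝ) (hθ : 0 ≤ θ) :
    sSup ((fun Δ : Fin d → Fin m → ℝ => ∑ i, y i * ∑ j, Δ i j * x j) ''
        {Δ | opNorm Nm Δ ≤ θ})
      = θ * (⨆ i, |y i|) * Nm x ∧
    ∀ (xt : Fin m → ℝ) (yt : Fin d → ℝ),
      dot xt x = Nm x → dualNorm Nm xt = 1 →
      dot yt y = (⨆ i, |y i|) → (∑ i, |yt i|) = 1 →
      opNorm Nm (fun i j => θ * yt i * xt j) ≤ θ ∧
        (∑ i, y i * ∑ j, (θ * yt i * xt j) * x j) = θ * (⨆ i, |y i|) * Nm x := by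
  have hval : ∀ Δ : Fin d → Fin m → ℝ, opNorm Nm Δ ≤ θ →
      ∑ i, y i * ∑ j, Δ i j * x j ≤ θ * (⨆ i, |y i|) * Nm x := fun Δ hΔ => by
    have hy : 0 ≤ ⨆ i, |y i| := Real.iSup_nonneg fun i => abs_nonneg _
    have hx := hNm.nonneg x
    calc ∑ i, y i * ∑ j, Δ i j * x j
        ≤ (⨆ i, |y i|) * ∑ i, |∑ j, Δ i j * x j| := sum_mul_le_iSup_abs_mul_sum_abs _ _
      _ ≤ (⨆ i, |y i|) * (opNorm Nm Δ * Nm x) := by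
        gcongr
        exact hNm.sum_abs_le_opNorm_mul Δ x
      _ ≤ (⨆ i, |y i|) * (θ * Nm x) := by gcongr
      _ = θ * (⨆ i, |y i|) * Nm x := by ring
  refine ⟨?_, fun xt yt hxt hxt1 hyt hyt1 => ⟨hNm.opNorm_rankOne_le hθ (fun v => ?_) hyt1.le, ?_⟩⟩
  · obtain ⟨u, hu, hux⟩ := hNm.exists_norming_vector x
    obtain ⟨w, hw, hwy⟩ := exists_dot_eq_iSup_abs y
    refine IsGreatest.csSup_eq ⟨⟨fun i j => θ * w i * u j, hNm.opNorm_rankOne_le hθ hu hw, ?_⟩, ?_⟩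
    · simp only [sum_mul_rankOne, hux, hwy]
    · rintro _ ⟨Δ, hΔ, rfl⟩
      exact hval Δ hΔ
  · simpa [hxt1] using hNm.abs_dot_le_dualNorm_mul xt v
  · rw [sum_mul_rankOne, hxt, hyt]

end NestedDRO
end
end

section
/- Let ‖·‖ be a norm on ℝ^d, let ℓ : ℝ^d → ℝ be convex, let b̂ ∈ ℝ^d and λ ≥ 0, and let L(ℓ) = sup{ (ℓ(b) − ℓ(b'))/‖b − b'‖ : b, b' ∈ ℝ^d, b ≠ b' } ∈ [0,∞] be the Lipschitz constant of ℓ with respect to ‖·‖. If λ ≥ L(ℓ), then sup_{b∈ℝ^d} { ℓ(b) − λ‖b − b̂‖ } = ℓ(b̂). If λ < L(ℓ), then sup_{b∈ℝ^d} { ℓ(b) − λ‖b − b̂‖ } = +∞. -/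
noncomputable section

namespace NestedDRO

/-- The (possibly infinite) Lipschitz constant of `ℓ` with respect to the norm `N`,
as an extended real. -/
def lipConst {d : ℕ} (N : (Fin d → ℝ) → ℝ) (ℓ : (Fin d → ℝ) → ℝ) : EReal :=
  ⨆ (b : Fin d → ℝ) (b' : Fin d → ℝ) (_ : b ≠ b'), (((ℓ b - ℓ b') / N (b - b') : ℝ) : EReal)

theorem IsNorm.nonneg_s19 {V : Type*} [AddCommGroup V] [Module ℝ V] {N : V → ℝ} (hN : IsNorm N)
    (v : V) : 0 ≤ N v := by
  obtain ⟨h0, hsmul, hadd⟩ := hN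
  have hneg := hsmul (-1) v
  have htri := hadd v ((-1 : ℝ) • v)
  have hzero : v + (-1 : ℝ) • v = 0 := by simp
  rw [hzero, (h0 0).2 rfl, hneg] at htri
  norm_num at htri
  linarith

theorem IsNorm.pos {V : Type*} [AddCommGroup V] [Module ℝ V] {N : V → ℝ} (hN : IsNorm N)
    {v : V} (hv : v ≠ 0) : 0 < N v :=
  lt_of_le_of_ne (hN.nonneg_s19 v) fun h => hv ((hN.1 v).1 h.symm)

/-- A convex function lies above its chord through `x` and `x + u` beyond `x + u`. -/
theorem _root_.ConvexOn.add_mul_sub_le {V : Type*} [AddCommGroup V] [Module ℝ V] {f : V → ℝ}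
    (hf : ConvexOn ℝ Set.univ f) (x u : V) {t : ℝ} (ht : 1 ≤ t) :
    f x + t * (f (x + u) - f x) ≤ f (x + t • u) := by
  have ht0 : 0 < t := by linarith
  have hconv := hf.2 (Set.mem_univ x) (Set.mem_univ (x + t • u))
    (sub_nonneg.2 (inv_le_one_of_one_le₀ ht)) (inv_nonneg.2 ht0.le) (sub_add_cancel 1 t⁻¹)
  have hpt : (1 - t⁻¹) • x + t⁻¹ • (x + t • u) = x + u := by
    rw [smul_add, inv_smul_smul₀ ht0.ne', sub_smul, one_smul]
    abel
  rw [hpt, smul_eq_mul, smul_eq_mul] at hconv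
  have hmul := mul_le_mul_of_nonneg_left hconv ht0.le
  have hexp : t * ((1 - t⁻¹) * f x + t⁻¹ * f (x + t • u)) = (t - 1) * f x + f (x + t • u) := by
    field_simp
  linarith

/-- Let `ℓ : ℝ^d → ℝ` be convex with Lipschitz constant `L(ℓ) ∈ [0,∞]`
with respect to a norm `‖·‖`, let `b̂ ∈ ℝ^d` and `λ ≥ 0`. If `λ ≥ L(ℓ)` then
`sup_b { ℓ(b) − λ‖b − b̂‖ } = ℓ(b̂)`; if `λ < L(ℓ)` then the supremum is `+∞`. -/
theorem statement19 {d : ℕ} (Nm : (Fin d → ℝ) → ℝ) (hNm : IsNorm Nm)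
    (ℓ : (Fin d → ℝ) → ℝ) (hℓ : ConvexOn ℝ Set.univ ℓ)
    (bh : Fin d → ℝ) (lam : ℝ) (hlam : 0 ≤ lam) :
    (lipConst Nm ℓ ≤ ((lam : ℝ) : EReal) →
      (⨆ b : Fin d → ℝ, ((ℓ b - lam * Nm (b - bh) : ℝ) : EReal)) = ((ℓ bh : ℝ) : EReal)) ∧
    (((lam : ℝ) : EReal) < lipConst Nm ℓ →
      (⨆ b : Fin d → ℝ, ((ℓ b - lam * Nm (b - bh) : ℝ) : EReal)) = (⊤ : EReal)) := by
  have hNm0 : Nm 0 = 0 := (hNm.1 0).2 rfl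
  constructor
  · intro hL
    refine le_antisymm (iSup_le fun b => EReal.coe_le_coe_iff.2 ?_) ?_
    · rcases eq_or_ne b bh with rfl | hb
      · simp [hNm0]
      · have hquot : (((ℓ b - ℓ bh) / Nm (b - bh) : ℝ) : EReal) ≤ lam := by
          simp only [lipConst, iSup_le_iff] at hL
          exact hL b bh hb
        have hle := (div_le_iff₀ (hNm.pos (sub_ne_zero.2 hb))).1 (EReal.coe_le_coe_iff.1 hquot)
        linarith
    · refine le_iSup_of_le bh ?_
      simp [hNm0]
  · intro hL
    simp only [lipConst, lt_iSup_iff] at hL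
    obtain ⟨b, b', hb, hlt⟩ := hL
    have hslope := (lt_div_iff₀ (hNm.pos (sub_ne_zero.2 hb))).1 (EReal.coe_lt_coe_iff.1 hlt)
    rw [EReal.eq_top_iff_forall_lt]
    intro y
    set δ := ℓ b - ℓ b' - lam * Nm (b - b')
    have hδ : 0 < δ := sub_pos.2 hslope
    obtain ⟨t, ht1, ht⟩ : ∃ t : ℝ, 1 ≤ t ∧ y - ℓ b' + lam * Nm (b' - bh) < t * δ :=
      ⟨max 1 ((y - ℓ b' + lam * Nm (b' - bh)) / δ + 1), le_max_left _ _,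
        (div_lt_iff₀ hδ).1 ((lt_add_one _).trans_le (le_max_right _ _))⟩
    refine lt_iSup_iff.2 ⟨b' + t • (b - b'), EReal.coe_lt_coe_iff.2 ?_⟩
    have hray := hℓ.add_mul_sub_le b' (b - b') ht1
    rw [add_sub_cancel] at hray
    have htri := hNm.2.2 (b' - bh) (t • (b - b'))
    rw [hNm.2.1, abs_of_nonneg (zero_le_one.trans ht1), sub_add_eq_add_sub] at htri
    have hmul := mul_le_mul_of_nonneg_left htri hlam
    have hexp : t * δ = t * (ℓ b - ℓ b') - lam * (t * Nm (b - b')) := by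
      simp only [δ]
      ring
    linarith

end NestedDRO
end
end
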